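/- (Lemma 1, part 1: monotonicity of the information prediction map.) Let A be an invertible real m×m matrix and Q a positive definite real m×m matrix. If I₁ and I₂ are positive semidefinite real m×m matrices with I₁ ⪯ I₂ (in the Loewner order), then 0 ⪯ ψ_{A,Q}(I₁) ⪯ ψ_{A,Q}(I₂). -/

import Mathlib

open Matrix

/-- Information-matrix prediction map of the distributed Kalman filter:
`ψ_{A,Q}(J) = (A⁻¹)ᵀ J A⁻¹ − (A⁻¹)ᵀ J (J + Aᵀ Q⁻¹ A)⁻¹ J A⁻¹`. -/
noncomputable def psi {m : ℕ} (A Q J : Matrix (Fin m) (Fin m) ℝ) :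
    Matrix (Fin m) (Fin m) ℝ :=
  (A⁻¹)ᵀ * J * A⁻¹ - (A⁻¹)ᵀ * J * (J + Aᵀ * Q⁻¹ * A)⁻¹ * J * A⁻¹

/-- Matrix inversion is antitone on positive definite matrices for the Loewner order. -/
theorem Matrix.PosDef.posSemidef_inv_sub_inv {n : Type*} [Fintype n] [DecidableEq n]
    {S T : Matrix n n ℝ} (hS : S.PosDef) (hT : T.PosDef) (h : (T - S).PosSemidef) :
    (S⁻¹ - T⁻¹).PosSemidef := by
  have hSd : IsUnit S.det := (isUnit_iff_isUnit_det S).1 hS.isUnit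
  have hTd : IsUnit T.det := (isUnit_iff_isUnit_det T).1 hT.isUnit
  have key : S⁻¹ - T⁻¹ = (T⁻¹)ᴴ * ((T - S) + (T - S)ᴴ * S⁻¹ * (T - S)) * T⁻¹ := by
    rw [hT.inv.isHermitian.eq, h.isHermitian.eq]
    have hfactor : (T - S) + (T - S) * S⁻¹ * (T - S) = T * S⁻¹ * T - T := by
      simp only [sub_mul, mul_sub, mul_nonsing_inv _ hSd, nonsing_inv_mul_cancel_right _ _ hSd,
        one_mul]
      abel
    rw [hfactor, mul_sub, sub_mul, nonsing_inv_mul _ hTd, one_mul, Matrix.mul_assoc T,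
      nonsing_inv_mul_cancel_left _ _ hTd, mul_nonsing_inv_cancel_right _ _ hTd]
  rw [key]
  exact (h.add (hS.inv.posSemidef.conjTranspose_mul_mul_same _)).conjTranspose_mul_mul_same _

theorem sub_mul_inv_add_mul {n : Type*} [Fintype n] [DecidableEq n]
    {J W : Matrix n n ℝ} (h : IsUnit (J + W).det) :
    J - J * (J + W)⁻¹ * J = W - W * (J + W)⁻¹ * W := by
  obtain ⟨S, rfl⟩ : ∃ S, J = S - W := ⟨J + W, by simp⟩
  rw [sub_add_cancel] at h ⊢
  simp only [sub_mul, mul_sub, mul_nonsing_inv _ h, nonsing_inv_mul_cancel_right _ _ h, one_mul]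
  abel

theorem psi_eq_conj {m : ℕ} (A Q J : Matrix (Fin m) (Fin m) ℝ) :
    psi A Q J = (A⁻¹)ᵀ * (J - J * (J + Aᵀ * Q⁻¹ * A)⁻¹ * J) * A⁻¹ := by
  simp only [psi, mul_sub, sub_mul, Matrix.mul_assoc]

theorem psi_zero {m : ℕ} (A Q : Matrix (Fin m) (Fin m) ℝ) : psi A Q 0 = 0 := by
  simp [psi]

theorem posSemidef_psi_sub_psi {m : ℕ} {A Q J₁ J₂ : Matrix (Fin m) (Fin m) ℝ}
    (hA : IsUnit A.det) (hQ : Q.PosDef) (hJ₁ : J₁.PosSemidef) (hJ₂ : J₂.PosSemidef)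
    (hle : (J₂ - J₁).PosSemidef) : (psi A Q J₂ - psi A Q J₁).PosSemidef := by
  have hW : (Aᵀ * Q⁻¹ * A).PosDef :=
    ((isUnit_iff_isUnit_det A).2 hA).posDef_star_left_conjugate_iff.2 hQ.inv
  rw [psi_eq_conj, psi_eq_conj]
  generalize Aᵀ * Q⁻¹ * A = W at hW ⊢
  have hS₁ : (J₁ + W).PosDef := hW.posSemidef_add hJ₁
  have hS₂ : (J₂ + W).PosDef := hW.posSemidef_add hJ₂
  rw [sub_mul_inv_add_mul ((isUnit_iff_isUnit_det _).1 hS₁.isUnit),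
    sub_mul_inv_add_mul ((isUnit_iff_isUnit_det _).1 hS₂.isUnit), ← sub_mul, ← mul_sub,
    sub_sub_sub_cancel_left, ← sub_mul, ← mul_sub]
  have hinv := hS₁.posSemidef_inv_sub_inv hS₂ (by rwa [add_sub_add_right_eq_sub])
  have hconj := hinv.conjTranspose_mul_mul_same W
  rw [hW.isHermitian.eq] at hconj
  exact hconj.conjTranspose_mul_mul_same A⁻¹

theorem stmt_3 {m : ℕ} (A Q J₁ J₂ : Matrix (Fin m) (Fin m) ℝ)
    (hA : IsUnit A.det) (hQ : Q.PosDef)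
    (hJ₁ : J₁.PosSemidef) (hJ₂ : J₂.PosSemidef)
    (hle : (J₂ - J₁).PosSemidef) :
    (psi A Q J₁).PosSemidef ∧ (psi A Q J₂ - psi A Q J₁).PosSemidef := by
  refine ⟨?_, posSemidef_psi_sub_psi hA hQ hJ₁ hJ₂ hle⟩
  simpa [psi_zero] using posSemidef_psi_sub_psi hA hQ PosSemidef.zero hJ₁ (by simpa using hJ₁)
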